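/- Let Z ∈ ℝ^{n₁×n₂} with ‖Z‖_F = 1 admit a singular value decomposition Z = Σ_{r=1}^R σ_r u_r v_rᵀ, where σ_r > 0, the vectors u_1, …, u_R ∈ ℝ^{n₁} are orthonormal, the vectors v_1, …, v_R ∈ ℝ^{n₂} are orthonormal, each u_r has at most s₁ nonzero entries, and each v_r has at most s₂ nonzero entries. Then Z ∈ (1/√R)·K_{s₁,s₂}^R. -/

import Mathlib

open MeasureTheory ProbabilityTheory Filter Matrix Pointwise

noncomputable section

/-- Measurable space structure on matrices (entrywise product σ-algebra). -/
instance {m n α : Type*} [MeasurableSpace α] : MeasurableSpace (Matrix m n α) :=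
  MeasurableSpace.pi (m := fun _ : m => MeasurableSpace.pi (m := fun _ : n => inferInstance))

/-- Frobenius inner product of two real matrices. -/
def frob {n₁ n₂ : ℕ} (A B : Matrix (Fin n₁) (Fin n₂) ℝ) : ℝ :=
  ∑ i, ∑ j, A i j * B i j

/-- Frobenius norm of a real matrix. -/
def frobNorm {n₁ n₂ : ℕ} (A : Matrix (Fin n₁) (Fin n₂) ℝ) : ℝ :=
  Real.sqrt (∑ i, ∑ j, A i j ^ 2)

/-- Entrywise ℓ¹-norm of a real matrix. -/
def l1Norm {n₁ n₂ : ℕ} (A : Matrix (Fin n₁) (Fin n₂) ℝ) : ℝ :=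
  ∑ i, ∑ j, |A i j|

/-- Euclidean (ℓ²) norm of a vector in ℝ^m. -/
def l2Norm {m : ℕ} (y : Fin m → ℝ) : ℝ :=
  Real.sqrt (∑ i, y i ^ 2)

/-- The linear measurement operator `A(Z)ᵢ = (1/√m)·⟨Aᵢ, Z⟩_F` determined by matrices `A i`. -/
def measOp {n₁ n₂ m : ℕ} (A : Fin m → Matrix (Fin n₁) (Fin n₂) ℝ)
    (Z : Matrix (Fin n₁) (Fin n₂) ℝ) : Fin m → ℝ :=
  fun i => (1 / Real.sqrt m) * frob (A i) Z

/-- The multi-penalty functional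
`J(U,V) = ‖y − A(UVᵀ)‖₂² + α₁‖U‖_F² + α₂‖U‖₁ + β₁‖V‖_F² + β₂‖V‖₁`. -/
def Jfun {n₁ n₂ m R : ℕ} (A : Fin m → Matrix (Fin n₁) (Fin n₂) ℝ) (y : Fin m → ℝ)
    (α₁ α₂ β₁ β₂ : ℝ) (U : Matrix (Fin n₁) (Fin R) ℝ) (V : Matrix (Fin n₂) (Fin R) ℝ) : ℝ :=
  l2Norm (fun i => y i - measOp A (U * Vᵀ) i) ^ 2 + α₁ * frobNorm U ^ 2 + α₂ * l1Norm U
    + β₁ * frobNorm V ^ 2 + β₂ * l1Norm V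

/-- The signal set `K_{s₁,s₂}^R` of matrices `Z = UVᵀ` with
`max{‖U‖_F², ‖V‖_F²} ≤ R`, `‖U‖₁ ≤ R√s₁`, `‖V‖₁ ≤ R√s₂`. -/
def Kset (n₁ n₂ : ℕ) (R : ℕ) (s₁ s₂ : ℝ) : Set (Matrix (Fin n₁) (Fin n₂) ℝ) :=
  {Z | ∃ (U : Matrix (Fin n₁) (Fin R) ℝ) (V : Matrix (Fin n₂) (Fin R) ℝ),
    Z = U * Vᵀ ∧ max (frobNorm U ^ 2) (frobNorm V ^ 2) ≤ (R : ℝ) ∧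
    l1Norm U ≤ (R : ℝ) * Real.sqrt s₁ ∧ l1Norm V ≤ (R : ℝ) * Real.sqrt s₂}

/-- The squared Frobenius norm is the sum of the squared entries. -/
lemma frobNorm_sq {n₁ n₂ : ℕ} (A : Matrix (Fin n₁) (Fin n₂) ℝ) :
    frobNorm A ^ 2 = ∑ i, ∑ j, A i j ^ 2 :=
  Real.sq_sqrt (by positivity)

/-- The squared Frobenius norm of a singular value decomposition is the sum of the squared
singular values. -/
lemma frobNorm_sum_smul_vecMulVec_sq {n₁ n₂ R : ℕ} (σ : Fin R → ℝ)
    (u : Fin R → Fin n₁ → ℝ) (v : Fin R → Fin n₂ → ℝ)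
    (hu : ∀ r r', ∑ j, u r j * u r' j = if r = r' then (1 : ℝ) else 0)
    (hv : ∀ r r', ∑ j, v r j * v r' j = if r = r' then (1 : ℝ) else 0) :
    frobNorm (∑ r, σ r • Matrix.vecMulVec (u r) (v r)) ^ 2 = ∑ r, σ r ^ 2 := by
  have hexpand (i : Fin n₁) (j : Fin n₂) :
      (∑ r, σ r • Matrix.vecMulVec (u r) (v r)) i j ^ 2 =
        ∑ r, ∑ r', σ r * σ r' * (u r i * u r' i) * (v r j * v r' j) := by
    simp only [Matrix.sum_apply, Matrix.smul_apply, Matrix.vecMulVec_apply, smul_eq_mul, sq,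
      Finset.sum_mul_sum]
    exact Finset.sum_congr rfl fun r _ => Finset.sum_congr rfl fun r' _ => by ring
  calc frobNorm (∑ r, σ r • Matrix.vecMulVec (u r) (v r)) ^ 2
      = ∑ i, ∑ r, ∑ r', σ r * σ r' * (u r i * u r' i) * ∑ j, v r j * v r' j := by
        rw [frobNorm_sq]
        refine Finset.sum_congr rfl fun i _ => ?_
        simp only [hexpand, Finset.mul_sum]
        rw [Finset.sum_comm]
        exact Finset.sum_congr rfl fun r _ => Finset.sum_comm
    _ = ∑ r, σ r ^ 2 * ∑ i, u r i * u r i := by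
        simp only [hv, mul_ite, mul_one, mul_zero, Finset.sum_ite_eq, Finset.mem_univ, if_true,
          Finset.mul_sum, sq]
        exact Finset.sum_comm
    _ = ∑ r, σ r ^ 2 := by simp [hu]

/-- A Euclidean unit vector with at most `s` nonzero entries has ℓ¹-norm at most `√s`. -/
lemma sum_abs_le_sqrt_of_card_support_le {n : ℕ} {s : ℝ} (x : Fin n → ℝ)
    (hx : ∑ j, x j ^ 2 = 1)
    (hs : ((Finset.univ.filter fun j => x j ≠ 0).card : ℝ) ≤ s) :
    ∑ j, |x j| ≤ Real.sqrt s := by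
  apply Real.le_sqrt_of_sq_le
  have hsupp : ∑ j ∈ Finset.univ.filter (fun j => x j ≠ 0), |x j| = ∑ j, |x j| :=
    Finset.sum_filter_of_ne fun j _ h => abs_ne_zero.mp h
  have hle : ∑ j ∈ Finset.univ.filter (fun j => x j ≠ 0), |x j| ^ 2 ≤ 1 := by
    simp only [sq_abs]
    rw [← hx]
    exact Finset.sum_le_sum_of_subset_of_nonneg (Finset.filter_subset _ _)
      fun j _ _ => sq_nonneg _
  rw [← hsupp]
  calc _ ≤ _ := sq_sum_le_card_mul_sum_sq
    _ ≤ ((Finset.univ.filter fun j => x j ≠ 0).card : ℝ) * 1 := by gcongr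
    _ ≤ s := by rwa [mul_one]

/-- A real family over `Fin R` with sum of squares at most `R` has sum at most `R`. -/
lemma sum_le_of_sum_sq_le {R : ℕ} (c : Fin R → ℝ) (hc : ∑ r, c r ^ 2 ≤ R) :
    ∑ r, c r ≤ R := by
  refine abs_le_of_sq_le_sq' ?_ R.cast_nonneg |>.2
  calc (∑ r, c r) ^ 2 ≤ (Finset.univ : Finset (Fin R)).card * ∑ r, c r ^ 2 :=
        sq_sum_le_card_mul_sum_sq
    _ ≤ (R : ℝ) * R := by
        rw [Finset.card_univ, Fintype.card_fin]
        gcongr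
    _ = (R : ℝ) ^ 2 := (sq _).symm

/-- Scaling unit columns by weights preserves the sum of squares. -/
lemma frobNorm_scaled_columns_sq {n R : ℕ} (c : Fin R → ℝ) (u : Fin R → Fin n → ℝ)
    (hu : ∀ r, ∑ j, u r j ^ 2 = 1) :
    frobNorm (Matrix.of fun i r => c r * u r i) ^ 2 = ∑ r, c r ^ 2 := by
  rw [frobNorm_sq, Finset.sum_comm]
  simp only [Matrix.of_apply, mul_pow, ← Finset.mul_sum, hu, mul_one]

/-- A matrix whose columns are nonnegative multiples of sparse unit vectors has small ℓ¹-norm. -/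
lemma l1Norm_scaled_columns_le {n R : ℕ} {s : ℝ} (c : Fin R → ℝ) (u : Fin R → Fin n → ℝ)
    (hc : ∀ r, 0 ≤ c r) (hu : ∀ r, ∑ j, u r j ^ 2 = 1)
    (hs : ∀ r, ((Finset.univ.filter fun j => u r j ≠ 0).card : ℝ) ≤ s) :
    l1Norm (Matrix.of fun i r => c r * u r i) ≤ (∑ r, c r) * Real.sqrt s := by
  rw [l1Norm, Finset.sum_comm, Finset.sum_mul]
  refine Finset.sum_le_sum fun r _ => ?_
  simp only [Matrix.of_apply, abs_mul, ← Finset.mul_sum, abs_of_nonneg (hc r)]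
  exact mul_le_mul_of_nonneg_left (sum_abs_le_sqrt_of_card_support_le _ (hu r) (hs r)) (hc r)

/-- unit-norm matrices with jointly sparse orthonormal SVD lie in
`(1/√R) K_{s₁,s₂}^R`. -/
theorem sparse_svd_mem_Kset {n₁ n₂ R : ℕ} (s₁ s₂ : ℝ)
    (Z : Matrix (Fin n₁) (Fin n₂) ℝ)
    (σ : Fin R → ℝ) (u : Fin R → Fin n₁ → ℝ) (v : Fin R → Fin n₂ → ℝ)
    (hZ : Z = ∑ r, σ r • Matrix.vecMulVec (u r) (v r))
    (hσ : ∀ r, 0 < σ r)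
    (hu : ∀ r r', ∑ j, u r j * u r' j = if r = r' then (1 : ℝ) else 0)
    (hv : ∀ r r', ∑ j, v r j * v r' j = if r = r' then (1 : ℝ) else 0)
    (hus : ∀ r, ((Finset.univ.filter fun j => u r j ≠ 0).card : ℝ) ≤ s₁)
    (hvs : ∀ r, ((Finset.univ.filter fun j => v r j ≠ 0).card : ℝ) ≤ s₂)
    (hnorm : frobNorm Z = 1) :
    Z ∈ (Real.sqrt R)⁻¹ • Kset n₁ n₂ R s₁ s₂ := by
  have hσsq : ∑ r, σ r ^ 2 = 1 := by
    rw [← frobNorm_sum_smul_vecMulVec_sq σ u v hu hv, ← hZ, hnorm, one_pow]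
  have hR : 0 < (R : ℝ) := by
    rcases Nat.eq_zero_or_pos R with rfl | h
    · simp at hσsq
    · exact_mod_cast h
  have hsqrt : 0 < Real.sqrt R := Real.sqrt_pos.mpr hR
  have hu1 (r : Fin R) : ∑ j, u r j ^ 2 = 1 := by simpa [sq] using hu r r
  have hv1 (r : Fin R) : ∑ j, v r j ^ 2 = 1 := by simpa [sq] using hv r r
  let c : Fin R → ℝ := fun r => Real.sqrt (Real.sqrt R * σ r)
  have hc0 (r : Fin R) : 0 ≤ c r := Real.sqrt_nonneg _
  have hcsq (r : Fin R) : c r ^ 2 = Real.sqrt R * σ r :=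
    Real.sq_sqrt (mul_pos hsqrt (hσ r)).le
  have hcsum : ∑ r, c r ^ 2 ≤ R := by
    simp only [hcsq]
    refine sum_le_of_sum_sq_le _ ?_
    simp only [mul_pow, ← Finset.mul_sum, hσsq, mul_one, Real.sq_sqrt hR.le, le_refl]
  have hcle : ∑ r, c r ≤ R := sum_le_of_sum_sq_le c hcsum
  rw [Set.mem_inv_smul_set_iff₀ hsqrt.ne']
  refine ⟨Matrix.of fun i r => c r * u r i, Matrix.of fun j r => c r * v r j, ?_, ?_, ?_, ?_⟩
  · ext i j
    simp only [hZ, Matrix.smul_apply, Matrix.sum_apply, Matrix.vecMulVec_apply, smul_eq_mul,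
      Matrix.mul_apply, Matrix.transpose_apply, Matrix.of_apply, Finset.mul_sum]
    refine Finset.sum_congr rfl fun r _ => ?_
    linear_combination -(u r i * v r j) * hcsq r
  · rw [frobNorm_scaled_columns_sq c u hu1, frobNorm_scaled_columns_sq c v hv1, max_self]
    exact hcsum
  · exact (l1Norm_scaled_columns_le c u hc0 hu1 hus).trans
      (mul_le_mul_of_nonneg_right hcle (Real.sqrt_nonneg _))
  · exact (l1Norm_scaled_columns_le c v hc0 hv1 hvs).trans
      (mul_le_mul_of_nonneg_right hcle (Real.sqrt_nonneg _))
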